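/- Let F be a face of codimension k ≥ 2 of a smooth lattice polytope P ⊆ ℝ^n, let u_F be its central normal with supporting value b = max_{x∈P} u_F·x, and let ε > 0 be such that u_F·v < b − ε for every vertex v of P not in F. Then the blow-up P_{F,ε} := P ∩ {x : u_F·x ≤ b − ε} is again a smooth polytope. -/

import Mathlib

open Finset

/-- Real dot product of an integer vector with a real vector. -/
def dotZ {n : ℕ} (u : Fin n → ℤ) (x : Fin n → ℝ) : ℝ := ∑ i, (u i : ℝ) * x i

/-- Real dot product. -/
def dotR {n : ℕ} (u x : Fin n → ℝ) : ℝ := ∑ i, u i * x i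

/-- A point of `ℝ^n` is a lattice point if all its coordinates are integers. -/
def IsLatticePt {n : ℕ} (x : Fin n → ℝ) : Prop := ∀ i, ∃ m : ℤ, x i = (m : ℝ)

/-- A (full-dimensional) lattice polytope: the convex hull of a finite set of
lattice points whose affine span is all of `ℝ^n`. -/
def IsLatticePolytope {n : ℕ} (P : Set (Fin n → ℝ)) : Prop :=
  ∃ V : Finset (Fin n → ℝ), (∀ v ∈ V, IsLatticePt v) ∧
    P = convexHull ℝ (V : Set (Fin n → ℝ)) ∧ affineSpan ℝ P = ⊤

/-- `F` is an (exposed) face of `P`: the set of maximizers over `P` of some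
linear functional. -/
def IsFaceOf {n : ℕ} (P F : Set (Fin n → ℝ)) : Prop :=
  ∃ u : Fin n → ℝ, F = {x ∈ P | ∀ y ∈ P, dotR u y ≤ dotR u x}

/-- The dimension of a subset of `ℝ^n` (dimension of its affine hull). -/
noncomputable def dimSet {n : ℕ} (F : Set (Fin n → ℝ)) : ℕ :=
  Module.finrank ℝ (vectorSpan ℝ F)

/-- A facet of `P`: a nonempty face of dimension `n - 1`. -/
def IsFacetOf {n : ℕ} (P F : Set (Fin n → ℝ)) : Prop :=
  IsFaceOf P F ∧ F.Nonempty ∧ dimSet F + 1 = n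

/-- A vertex of `P`: a point such that `{v}` is a face. -/
def IsVertexOf {n : ℕ} (P : Set (Fin n → ℝ)) (v : Fin n → ℝ) : Prop :=
  IsFaceOf P {v}

/-- An edge of `P`: a face which is a nondegenerate segment. -/
def IsEdgeOf {n : ℕ} (P E : Set (Fin n → ℝ)) : Prop :=
  IsFaceOf P E ∧ ∃ a b : Fin n → ℝ, a ≠ b ∧ E = segment ℝ a b

/-- An integer vector is primitive if the gcd of its coordinates is 1. -/
def IsPrimitiveZ {n : ℕ} (u : Fin n → ℤ) : Prop := Finset.univ.gcd u = 1

/-- `u` is the primitive outer normal of the facet `F` of `P`. -/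
def IsFacetNormal {n : ℕ} (P F : Set (Fin n → ℝ)) (u : Fin n → ℤ) : Prop :=
  IsPrimitiveZ u ∧ IsFacetOf P F ∧
    F = {x ∈ P | ∀ y ∈ P, dotZ u y ≤ dotZ u x}

/-- `u` is the central normal vector of the face `G` of `P`: the sum of the
primitive outer normals of all the facets of `P` containing `G`. -/
def IsCentralNormal {n : ℕ} (P G : Set (Fin n → ℝ)) (u : Fin n → ℤ) : Prop :=
  ∃ (m : ℕ) (Fs : Fin m → Set (Fin n → ℝ)) (us : Fin m → Fin n → ℤ),
    Function.Injective Fs ∧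
    (∀ i, G ⊆ Fs i ∧ IsFacetNormal P (Fs i) (us i)) ∧
    (∀ F, IsFacetOf P F → G ⊆ F → ∃ i, F = Fs i) ∧
    u = ∑ i, us i

/-- The lattice length of the segment from `a` to `b`. -/
def LatticeLength {n : ℕ} (a b : Fin n → ℝ) (ℓ : ℕ) : Prop :=
  ∃ d : Fin n → ℤ, IsPrimitiveZ d ∧ ∀ i, b i - a i = (ℓ : ℝ) * (d i : ℝ)

/-- `d` is the primitive integer direction vector of the edge `E` at its
endpoint `v`, pointing away from `v`. -/
def EdgeDirAt {n : ℕ} (v : Fin n → ℝ) (E : Set (Fin n → ℝ)) (d : Fin n → ℤ) : Prop :=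
  IsPrimitiveZ d ∧ ∃ w ∈ E, ∃ t : ℝ, 0 < t ∧ ∀ i, w i - v i = t * (d i : ℝ)

/-- A polytope is smooth (Delzant) if every vertex lies in exactly `n` facets
and the primitive direction vectors of the `n` edges incident to each vertex
form a basis of the lattice `ℤ^n`. -/
def IsSmoothPolytope {n : ℕ} (P : Set (Fin n → ℝ)) : Prop :=
  ∀ v : Fin n → ℝ, IsVertexOf P v →
    (∃ Fs : Fin n → Set (Fin n → ℝ), Function.Injective Fs ∧
      (∀ i, IsFacetOf P (Fs i) ∧ v ∈ Fs i) ∧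
      (∀ F, IsFacetOf P F → v ∈ F → ∃ i, F = Fs i)) ∧
    (∃ (E : Fin n → Set (Fin n → ℝ)) (d : Fin n → Fin n → ℤ),
      Function.Injective E ∧
      (∀ i, IsEdgeOf P (E i) ∧ v ∈ E i ∧ EdgeDirAt v (E i) (d i)) ∧
      (∀ E', IsEdgeOf P E' → v ∈ E' → ∃ i, E' = E i) ∧
      IsUnit (Matrix.det (Matrix.of d)))

/-- A polytope is reflexive if the origin is in its interior and every facet is
supported at value `1` by its primitive outer normal. -/
def IsReflexivePolytope {n : ℕ} (P : Set (Fin n → ℝ)) : Prop :=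
  (0 : Fin n → ℝ) ∈ interior P ∧
  ∀ F u, IsFacetNormal P F u → ∀ x ∈ F, dotZ u x = 1

/-- A monotone polytope (= smooth reflexive polytope). -/
def IsMonotonePolytope {n : ℕ} (P : Set (Fin n → ℝ)) : Prop :=
  IsLatticePolytope P ∧ IsSmoothPolytope P ∧ IsReflexivePolytope P

/-- `F` is a nonempty face of `P` of codimension `k`. -/
def HasCodim {n : ℕ} (P F : Set (Fin n → ℝ)) (k : ℕ) : Prop :=
  IsFaceOf P F ∧ F.Nonempty ∧ dimSet F + k = n

/-- The monotone blow-up `P ∩ {x : u·x ≤ 1}` of a monotone polytope at a face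
with central normal `u`. -/
def blowupSet {n : ℕ} (P : Set (Fin n → ℝ)) (u : Fin n → ℤ) : Set (Fin n → ℝ) :=
  {x ∈ P | dotZ u x ≤ 1}

/-- The region removed from `P` by the monotone blow-up with central normal `u`. -/
def removedRegion {n : ℕ} (P : Set (Fin n → ℝ)) (u : Fin n → ℤ) : Set (Fin n → ℝ) :=
  {x ∈ P | 1 < dotZ u x}

/-- `P` admits a monotone blow-up at its face `F` with central normal `u`:
every vertex of `P` not in `F` satisfies `u·v ≤ 0`, and the blow-up is again a
monotone polytope. -/
def AdmitsMonotoneBlowup {n : ℕ} (P F : Set (Fin n → ℝ)) (u : Fin n → ℤ) : Prop :=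
  IsCentralNormal P F u ∧
  (∀ v, IsVertexOf P v → v ∉ F → dotZ u v ≤ 0) ∧
  IsMonotonePolytope (blowupSet P u)

/-- The monotone simplex `{x : x i ≥ -1 ∀ i, ∑ x i ≤ 1}` in `ℝ^n`. -/
def monotoneSimplex (n : ℕ) : Set (Fin n → ℝ) :=
  {x | (∀ i, -1 ≤ x i) ∧ ∑ i, x i ≤ 1}

/-- `AGL(n,ℤ)`-equivalence of subsets of `ℝ^n`: some map `x ↦ Ax + t` with
`A ∈ GL(n,ℤ)` and `t ∈ ℤ^n` maps `P` onto `Q`. -/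
def AGLEquiv {n : ℕ} (P Q : Set (Fin n → ℝ)) : Prop :=
  ∃ (A : Matrix (Fin n) (Fin n) ℤ) (t : Fin n → ℤ), IsUnit A.det ∧
    (fun x : Fin n → ℝ => fun i => (∑ j, (A i j : ℝ) * x j) + (t i : ℝ)) '' P = Q

/-- An integer vector viewed as a real vector. -/
def realVec {n : ℕ} (u : Fin n → ℤ) : Fin n → ℝ := fun i => (u i : ℝ)

section DotProducts

variable {n : ℕ}

lemma dotR_eq_dotProduct (c x : Fin n → ℝ) : dotR c x = c ⬝ᵥ x := rfl

lemma dotZ_eq_dotProduct (u : Fin n → ℤ) (x : Fin n → ℝ) : dotZ u x = realVec u ⬝ᵥ x := rfl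

lemma dotZ_eq_dotR (u : Fin n → ℤ) (x : Fin n → ℝ) : dotZ u x = dotR (realVec u) x := rfl

lemma dotZ_add (u : Fin n → ℤ) (x y : Fin n → ℝ) : dotZ u (x + y) = dotZ u x + dotZ u y := by
  simp only [dotZ_eq_dotProduct, dotProduct_add]

lemma dotZ_sub (u : Fin n → ℤ) (x y : Fin n → ℝ) : dotZ u (x - y) = dotZ u x - dotZ u y := by
  simp only [dotZ_eq_dotProduct, dotProduct_sub]

lemma dotZ_smul (u : Fin n → ℤ) (r : ℝ) (x : Fin n → ℝ) : dotZ u (r • x) = r * dotZ u x := by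
  simp only [dotZ_eq_dotProduct, dotProduct_smul, smul_eq_mul]

lemma dotZ_neg (u : Fin n → ℤ) (x : Fin n → ℝ) : dotZ u (-x) = -dotZ u x := by
  simp only [dotZ_eq_dotProduct, dotProduct_neg]

lemma dotZ_zero (u : Fin n → ℤ) : dotZ u 0 = 0 := by
  simp only [dotZ_eq_dotProduct, dotProduct_zero]

lemma dotZ_sum {ι : Type*} (u : Fin n → ℤ) (s : Finset ι) (f : ι → Fin n → ℝ) :
    dotZ u (∑ i ∈ s, f i) = ∑ i ∈ s, dotZ u (f i) := by
  simp only [dotZ_eq_dotProduct, dotProduct_sum]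

lemma sum_dotZ {ι : Type*} (s : Finset ι) (f : ι → Fin n → ℤ) (x : Fin n → ℝ) :
    dotZ (∑ i ∈ s, f i) x = ∑ i ∈ s, dotZ (f i) x := by
  simp only [dotZ, Finset.sum_apply, Int.cast_sum, Finset.sum_mul]
  exact Finset.sum_comm

lemma neg_dotZ (u : Fin n → ℤ) (x : Fin n → ℝ) : dotZ (-u) x = -dotZ u x := by
  simp [dotZ]

lemma dotZ_realVec (u w : Fin n → ℤ) : dotZ u (realVec w) = ((u ⬝ᵥ w : ℤ) : ℝ) := by
  simp [dotZ, realVec, dotProduct]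

lemma continuous_dotZ (u : Fin n → ℤ) : Continuous (dotZ u) := by
  unfold dotZ
  fun_prop

lemma convex_le_dotZ (u : Fin n → ℤ) (r : ℝ) : Convex ℝ {x | r ≤ dotZ u x} :=
  convex_halfSpace_ge ⟨dotZ_add u, dotZ_smul u⟩ r

lemma convex_dotZ_le (u : Fin n → ℤ) (r : ℝ) : Convex ℝ {x | dotZ u x ≤ r} :=
  convex_halfSpace_le ⟨dotZ_add u, dotZ_smul u⟩ r

lemma dotR_add (c x y : Fin n → ℝ) : dotR c (x + y) = dotR c x + dotR c y := by
  simp only [dotR_eq_dotProduct, dotProduct_add]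

lemma dotR_sub (c x y : Fin n → ℝ) : dotR c (x - y) = dotR c x - dotR c y := by
  simp only [dotR_eq_dotProduct, dotProduct_sub]

lemma dotR_smul (c : Fin n → ℝ) (r : ℝ) (x : Fin n → ℝ) : dotR c (r • x) = r * dotR c x := by
  simp only [dotR_eq_dotProduct, dotProduct_smul, smul_eq_mul]

lemma dotR_sum {ι : Type*} (c : Fin n → ℝ) (s : Finset ι) (f : ι → Fin n → ℝ) :
    dotR c (∑ i ∈ s, f i) = ∑ i ∈ s, dotR c (f i) := by
  simp only [dotR_eq_dotProduct, dotProduct_sum]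

lemma exists_dotR_eq (f : (Fin n → ℝ) →ₗ[ℝ] ℝ) : ∃ c : Fin n → ℝ, ∀ x, f x = dotR c x := by
  refine ⟨fun i => f (Pi.single i 1), fun x => ?_⟩
  conv_lhs => rw [pi_eq_sum_univ' x]
  simp [dotR, mul_comm, Pi.single]

end DotProducts

section FeasibleDirections

variable {n : ℕ}

/-- `z` is a feasible direction of `Q` at `q`: some point of the open ray from `q` in direction `z`
lies in `Q`. -/
def IsFeasibleDir (Q : Set (Fin n → ℝ)) (q z : Fin n → ℝ) : Prop := ∃ s : ℝ, 0 < s ∧ q + s • z ∈ Q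

variable {Q : Set (Fin n → ℝ)} {q z w : Fin n → ℝ}

lemma IsFeasibleDir.of_mem (hz : z ∈ Q) : IsFeasibleDir Q q (z - q) :=
  ⟨1, one_pos, by simpa using hz⟩

lemma IsFeasibleDir.exists_forall_le (hQ : Convex ℝ Q) (hq : q ∈ Q) (h : IsFeasibleDir Q q z) :
    ∃ s : ℝ, 0 < s ∧ ∀ r : ℝ, 0 ≤ r → r ≤ s → q + r • z ∈ Q := by
  obtain ⟨s, hs, hz⟩ := h
  refine ⟨s, hs, fun r hr hrs => ?_⟩
  have := hQ.add_smul_sub_mem hq hz (t := r / s)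
    ⟨div_nonneg hr hs.le, (div_le_one hs).2 hrs⟩
  rwa [add_sub_cancel_left, smul_smul, div_mul_cancel₀ _ hs.ne'] at this

lemma IsFeasibleDir.smul (h : IsFeasibleDir Q q z) {r : ℝ} (hr : 0 < r) :
    IsFeasibleDir Q q (r • z) := by
  obtain ⟨s, hs, hz⟩ := h
  exact ⟨s / r, div_pos hs hr, by rwa [smul_smul, div_mul_cancel₀ _ hr.ne']⟩

lemma IsFeasibleDir.zero (hq : q ∈ Q) : IsFeasibleDir Q q 0 := ⟨1, one_pos, by simpa using hq⟩

lemma IsFeasibleDir.add (hQ : Convex ℝ Q) (hq : q ∈ Q) (hz : IsFeasibleDir Q q z)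
    (hw : IsFeasibleDir Q q w) : IsFeasibleDir Q q (z + w) := by
  obtain ⟨s, hs, hz⟩ := hz.exists_forall_le hQ hq
  obtain ⟨t, ht, hw⟩ := hw.exists_forall_le hQ hq
  have hm : 0 < min s t := lt_min hs ht
  refine ⟨min s t / 2, half_pos hm, ?_⟩
  have h1 := hz (min s t) hm.le (min_le_left _ _)
  have h2 := hw (min s t) hm.le (min_le_right _ _)
  have := hQ h1 h2 (a := 1 / 2) (b := 1 / 2) (by norm_num) (by norm_num) (by norm_num)
  convert this using 1
  module

lemma IsFeasibleDir.sum {ι : Type*} (hQ : Convex ℝ Q) (hq : q ∈ Q) (s : Finset ι)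
    (f : ι → Fin n → ℝ) (hf : ∀ i ∈ s, IsFeasibleDir Q q (f i)) :
    IsFeasibleDir Q q (∑ i ∈ s, f i) :=
  Finset.sum_induction f (IsFeasibleDir Q q) (fun _ _ => IsFeasibleDir.add hQ hq) (.zero hq) hf

lemma eq_zero_of_mem_extremePoints (hQ : Convex ℝ Q) (hq : q ∈ Q.extremePoints ℝ)
    (h₁ : IsFeasibleDir Q q z) (h₂ : IsFeasibleDir Q q (-z)) : z = 0 := by
  obtain ⟨s, hs, h₁⟩ := h₁.exists_forall_le hQ hq.1
  obtain ⟨t, ht, h₂⟩ := h₂.exists_forall_le hQ hq.1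
  have hm : 0 < min s t := lt_min hs ht
  have := (mem_extremePoints.1 hq).2 _ (h₁ (min s t) hm.le (min_le_left _ _)) _
    (h₂ (min s t) hm.le (min_le_right _ _))
    ⟨1 / 2, 1 / 2, by norm_num, by norm_num, by norm_num, by module⟩
  have h := this.1
  rw [add_eq_left, smul_eq_zero] at h
  exact h.resolve_left hm.ne'

end FeasibleDirections

/-- `Q` has at `q` a unimodular simplicial corner with inner facet normals `a` and edge directions
`d`: the vectors `a` and `d` are dual lattice bases, `Q` is contained in the cone at `q` spanned by
`d`, and every `d i` is a feasible direction. -/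
structure IsUnimodularCorner {n : ℕ} (Q : Set (Fin n → ℝ)) (q : Fin n → ℝ)
    (a d : Fin n → Fin n → ℤ) : Prop where
  mem : q ∈ Q
  dual : ∀ i j, a i ⬝ᵥ d j = if i = j then 1 else 0
  nonneg : ∀ x ∈ Q, ∀ i, 0 ≤ dotZ (a i) (x - q)
  feasible : ∀ i, IsFeasibleDir Q q (realVec (d i))

/-- The points of `Q` lying on the supporting hyperplanes at `q` with normals `a j`, `j ∈ J`. -/
def cornerFace {n : ℕ} (Q : Set (Fin n → ℝ)) (q : Fin n → ℝ) (a : Fin n → Fin n → ℤ)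
    (J : Finset (Fin n)) : Set (Fin n → ℝ) :=
  {x ∈ Q | ∀ j ∈ J, dotZ (a j) (x - q) = 0}

section DualBases

variable {n : ℕ} {a d : Fin n → Fin n → ℤ}

lemma matrix_mul_transpose_of_dual (h : ∀ i j, a i ⬝ᵥ d j = if i = j then 1 else 0) :
    Matrix.of a * (Matrix.of d).transpose = 1 := by
  ext i j
  rw [Matrix.mul_apply', Matrix.one_apply]
  exact h i j

lemma matrix_transpose_mul_of_dual (h : ∀ i j, a i ⬝ᵥ d j = if i = j then 1 else 0) :
    (Matrix.of d).transpose * Matrix.of a = 1 :=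
  mul_eq_one_comm.1 (matrix_mul_transpose_of_dual h)

lemma sum_mul_of_dual (h : ∀ i j, a i ⬝ᵥ d j = if i = j then 1 else 0) (i j : Fin n) :
    ∑ l, d l i * a l j = if i = j then 1 else 0 := by
  have := congrFun (congrFun (matrix_transpose_mul_of_dual h) i) j
  rwa [Matrix.mul_apply, Matrix.one_apply] at this

lemma isUnit_det_of_dual (h : ∀ i j, a i ⬝ᵥ d j = if i = j then 1 else 0) :
    IsUnit (Matrix.det (Matrix.of d)) := by
  rw [← Matrix.det_transpose]
  exact Matrix.isUnit_det_of_left_inverse (matrix_mul_transpose_of_dual h)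

lemma dotZ_realVec_of_dual (h : ∀ i j, a i ⬝ᵥ d j = if i = j then 1 else 0) (i j : Fin n) :
    dotZ (a i) (realVec (d j)) = if i = j then 1 else 0 := by
  rw [dotZ_realVec, h]
  split_ifs <;> simp

lemma eq_sum_smul_realVec_of_dual (h : ∀ i j, a i ⬝ᵥ d j = if i = j then 1 else 0)
    (x : Fin n → ℝ) : x = ∑ l, dotZ (a l) x • realVec (d l) := by
  ext i
  have key : ∀ j, ∑ l, (d l i : ℝ) * a l j = if i = j then 1 else 0 := fun j => by
    have := sum_mul_of_dual h i j
    have := congrArg (Int.cast : ℤ → ℝ) this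
    push_cast at this
    simpa using this
  simp only [Finset.sum_apply, Pi.smul_apply, smul_eq_mul, dotZ, realVec, Finset.sum_mul]
  rw [Finset.sum_comm]
  calc x i = ∑ j, (if i = j then 1 else 0) * x j := by simp
    _ = _ := Finset.sum_congr rfl fun j _ => by
      rw [← key, Finset.sum_mul]
      exact Finset.sum_congr rfl fun l _ => by ring

lemma eq_sum_dotProduct_smul_of_dual (h : ∀ i j, a i ⬝ᵥ d j = if i = j then 1 else 0)
    (w : Fin n → ℤ) : w = ∑ l, (w ⬝ᵥ d l) • a l := by
  ext j
  simp only [Finset.sum_apply, Pi.smul_apply, smul_eq_mul, dotProduct, Finset.sum_mul]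
  rw [Finset.sum_comm]
  calc w j = ∑ i, w i * (if i = j then 1 else 0) := by simp
    _ = _ := Finset.sum_congr rfl fun i _ => by
      rw [← sum_mul_of_dual h, Finset.mul_sum]
      exact Finset.sum_congr rfl fun l _ => by ring

lemma isPrimitiveZ_of_dual (h : ∀ i j, a i ⬝ᵥ d j = if i = j then 1 else 0) (i : Fin n) :
    IsPrimitiveZ (d i) := by
  have h1 : Finset.univ.gcd (d i) ∣ 1 := by
    have := h i i
    rw [if_pos rfl] at this
    rw [← this]
    exact Finset.dvd_sum fun k _ => Dvd.dvd.mul_left (Finset.gcd_dvd (Finset.mem_univ k)) _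
  have := Finset.normalize_gcd (s := Finset.univ) (f := d i)
  rw [IsPrimitiveZ, ← this]
  exact normalize_eq_one.2 (isUnit_of_dvd_one h1)

lemma linearIndependent_realVec_of_dual (h : ∀ i j, a i ⬝ᵥ d j = if i = j then 1 else 0) :
    LinearIndependent ℝ (fun i => realVec (d i)) := by
  rw [Fintype.linearIndependent_iff]
  intro g hg i
  have := congrArg (dotZ (a i)) hg
  simpa [dotZ_sum, dotZ_smul, dotZ_zero, dotZ_realVec_of_dual h] using this

end DualBases

namespace IsUnimodularCorner

variable {n : ℕ} {Q : Set (Fin n → ℝ)} {q : Fin n → ℝ} {a d : Fin n → Fin n → ℤ}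

lemma dotR_eq (h : IsUnimodularCorner Q q a d) (c x : Fin n → ℝ) :
    dotR c x = ∑ l, dotZ (a l) x * dotR c (realVec (d l)) := by
  conv_lhs => rw [eq_sum_smul_realVec_of_dual h.dual x]
  simp only [dotR_sum, dotR_smul]

lemma mem_cornerFace (h : IsUnimodularCorner Q q a d) (J : Finset (Fin n)) :
    q ∈ cornerFace Q q a J := ⟨h.mem, fun j _ => by rw [sub_self, dotZ_zero]⟩

lemma isFeasibleDir_cornerFace (h : IsUnimodularCorner Q q a d) {J : Finset (Fin n)} {l : Fin n}
    (hl : l ∉ J) : IsFeasibleDir (cornerFace Q q a J) q (realVec (d l)) := by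
  obtain ⟨s, hs, hm⟩ := h.feasible l
  refine ⟨s, hs, hm, fun j hj => ?_⟩
  rw [add_sub_cancel_left, dotZ_smul, dotZ_realVec_of_dual h.dual,
    if_neg (fun e : j = l => hl (e ▸ hj)), mul_zero]

lemma notMem_of_isFeasibleDir (h : IsUnimodularCorner Q q a d) {J : Finset (Fin n)} {l : Fin n}
    (hl : IsFeasibleDir (cornerFace Q q a J) q (realVec (d l))) : l ∉ J := by
  obtain ⟨s, hs, hm⟩ := hl
  intro hJ
  have := hm.2 l hJ
  rw [add_sub_cancel_left, dotZ_smul, dotZ_realVec_of_dual h.dual, if_pos rfl, mul_one] at this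
  exact hs.ne' this

lemma cornerFace_injective (h : IsUnimodularCorner Q q a d) :
    Function.Injective (cornerFace Q q a) := by
  intro J K hJK
  ext l
  rw [← not_iff_not]
  exact ⟨fun hl => h.notMem_of_isFeasibleDir (hJK ▸ h.isFeasibleDir_cornerFace hl),
    fun hl => h.notMem_of_isFeasibleDir (hJK ▸ h.isFeasibleDir_cornerFace hl)⟩

lemma isFaceOf_cornerFace (h : IsUnimodularCorner Q q a d) (J : Finset (Fin n)) :
    IsFaceOf Q (cornerFace Q q a J) := by
  have hval : ∀ x, dotR (realVec (-∑ j ∈ J, a j)) x =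
      dotR (realVec (-∑ j ∈ J, a j)) q - ∑ j ∈ J, dotZ (a j) (x - q) := fun x => by
    simp only [← dotZ_eq_dotR, neg_dotZ, sum_dotZ, dotZ_sub, Finset.sum_sub_distrib]
    ring
  refine ⟨realVec (-∑ j ∈ J, a j), ?_⟩
  ext x
  refine and_congr_right fun hx => ⟨fun hJ y hy => ?_, fun hmax => ?_⟩
  · rw [hval y, hval x, Finset.sum_eq_zero hJ]
    linarith [Finset.sum_nonneg fun j (_ : j ∈ J) => h.nonneg y hy j]
  · have := hmax q h.mem
    rw [hval x] at this
    exact (Finset.sum_eq_zero_iff_of_nonneg fun j _ => h.nonneg x hx j).1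
      (le_antisymm (by linarith) (Finset.sum_nonneg fun j _ => h.nonneg x hx j))

lemma exists_eq_cornerFace (h : IsUnimodularCorner Q q a d) {F : Set (Fin n → ℝ)}
    (hF : IsFaceOf Q F) (hq : q ∈ F) : ∃ J, F = cornerFace Q q a J := by
  obtain ⟨c, rfl⟩ := hF
  have hc : ∀ l, dotR c (realVec (d l)) ≤ 0 := fun l => by
    obtain ⟨s, hs, hm⟩ := h.feasible l
    have := hq.2 _ hm
    rw [dotR_add, dotR_smul] at this
    by_contra! hpos
    linarith [mul_pos hs hpos]
  refine ⟨Finset.univ.filter fun l => dotR c (realVec (d l)) ≠ 0, ?_⟩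
  ext x
  refine and_congr_right fun hx => ?_
  have hmax : (∀ y ∈ Q, dotR c y ≤ dotR c x) ↔ dotR c (x - q) = 0 := by
    rw [dotR_sub]
    exact ⟨fun hm => by linarith [hm q h.mem, hq.2 x hx], fun he y hy => by linarith [hq.2 y hy]⟩
  rw [hmax, h.dotR_eq, Finset.sum_eq_zero_iff_of_nonpos fun l _ =>
    mul_nonpos_of_nonneg_of_nonpos (h.nonneg x hx l) (hc l)]
  simp only [Finset.mem_univ, true_implies, Finset.mem_filter, true_and, mul_eq_zero]
  exact forall_congr' fun l => by tauto

lemma dimSet_cornerFace_add_card (h : IsUnimodularCorner Q q a d) (J : Finset (Fin n)) :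
    dimSet (cornerFace Q q a J) + J.card = n := by
  have hspan : vectorSpan ℝ (cornerFace Q q a J) =
      Submodule.span ℝ (Set.range fun l : {l // l ∉ J} => realVec (d l)) := by
    rw [vectorSpan_eq_span_vsub_set_right ℝ (h.mem_cornerFace J)]
    refine le_antisymm (Submodule.span_le.2 ?_) (Submodule.span_le.2 ?_)
    · rintro _ ⟨x, hx, rfl⟩
      simp only [vsub_eq_sub, SetLike.mem_coe]
      rw [eq_sum_smul_realVec_of_dual h.dual (x - q)]
      refine Submodule.sum_mem _ fun l _ => ?_
      by_cases hl : l ∈ J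
      · simp [hx.2 l hl]
      · exact Submodule.smul_mem _ _ (Submodule.subset_span ⟨⟨l, hl⟩, rfl⟩)
    · rintro _ ⟨⟨l, hl⟩, rfl⟩
      obtain ⟨s, hs, hm⟩ := h.isFeasibleDir_cornerFace hl
      have : s • realVec (d l) ∈
          Submodule.span ℝ ((fun x => x -ᵥ q) '' cornerFace Q q a J) :=
        Submodule.subset_span ⟨_, hm, by simp⟩
      exact (Submodule.smul_mem_iff _ hs.ne').1 this
  have hli : LinearIndependent ℝ fun l : {l // l ∉ J} => realVec (d l) :=
    (linearIndependent_realVec_of_dual h.dual).comp _ Subtype.val_injective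
  rw [dimSet, hspan, finrank_span_eq_card hli, Fintype.card_subtype_compl, Fintype.card_fin, Fintype.card_coe]
  exact Nat.sub_add_cancel (by simpa using J.card_le_univ)

end IsUnimodularCorner

lemma exists_segment_eq_ray {n : ℕ} {Q : Set (Fin n → ℝ)} {q z : Fin n → ℝ} (hQ : Convex ℝ Q)
    (hc : IsCompact Q) (hq : q ∈ Q) (hz : z ≠ 0) (hf : IsFeasibleDir Q q z) :
    ∃ w, q ≠ w ∧ {x ∈ Q | ∃ r : ℝ, 0 ≤ r ∧ x = q + r • z} = segment ℝ q w := by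
  have hT : IsCompact {r : ℝ | 0 ≤ r ∧ q + r • z ∈ Q} := by
    have he : Topology.IsClosedEmbedding fun r : ℝ => q + r • z :=
      (Homeomorph.addLeft q).isClosedEmbedding.comp (isClosedEmbedding_smul_left hz)
    exact (he.isCompact_preimage hc).inter_left isClosed_Ici
  obtain ⟨s, hs, hsQ⟩ := hf
  obtain ⟨t, ht, htmax⟩ := hT.exists_isMaxOn ⟨s, hs.le, hsQ⟩ continuousOn_id
  have htpos : 0 < t :=
    hs.trans_le (htmax (show s ∈ {r : ℝ | 0 ≤ r ∧ q + r • z ∈ Q} from ⟨hs.le, hsQ⟩))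
  refine ⟨q + t • z, fun e => ?_, ?_⟩
  · rw [eq_comm, add_eq_left, smul_eq_zero] at e
    exact e.elim htpos.ne' hz
  · rw [segment_eq_image']
    ext x
    constructor
    · rintro ⟨hx, r, hr, rfl⟩
      have hrt : r ≤ t := htmax (show r ∈ {r : ℝ | 0 ≤ r ∧ q + r • z ∈ Q} from ⟨hr, hx⟩)
      refine ⟨r / t, ⟨by positivity, (div_le_one htpos).2 hrt⟩, ?_⟩
      simp only [add_sub_cancel_left, smul_smul, div_mul_cancel₀ _ htpos.ne']
    · rintro ⟨θ, hθ, rfl⟩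
      refine ⟨hQ.add_smul_sub_mem hq ht.2 hθ, θ * t, mul_nonneg hθ.1 htpos.le, ?_⟩
      simp only [add_sub_cancel_left, smul_smul]

namespace IsUnimodularCorner

variable {n : ℕ} {Q : Set (Fin n → ℝ)} {q : Fin n → ℝ} {a d : Fin n → Fin n → ℤ}

lemma cornerFace_compl_singleton (h : IsUnimodularCorner Q q a d) (i : Fin n) :
    cornerFace Q q a {i}ᶜ = {x ∈ Q | ∃ r : ℝ, 0 ≤ r ∧ x = q + r • realVec (d i)} := by
  ext x
  refine and_congr_right fun hx => ⟨fun hJ => ⟨dotZ (a i) (x - q), h.nonneg x hx i, ?_⟩, ?_⟩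
  · have := eq_sum_smul_realVec_of_dual h.dual (x - q)
    rw [Finset.sum_eq_single i (fun l _ hl => by rw [hJ l (by simpa using hl), zero_smul])
      (by simp)] at this
    rw [← this]
    abel
  · rintro ⟨r, -, rfl⟩ j hj
    rw [add_sub_cancel_left, dotZ_smul, dotZ_realVec_of_dual h.dual, if_neg (by simpa using hj),
      mul_zero]

lemma smooth_at (h : IsUnimodularCorner Q q a d) (hQ : Convex ℝ Q) (hc : IsCompact Q) :
    (∃ Fs : Fin n → Set (Fin n → ℝ), Function.Injective Fs ∧
      (∀ i, IsFacetOf Q (Fs i) ∧ q ∈ Fs i) ∧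
      (∀ F, IsFacetOf Q F → q ∈ F → ∃ i, F = Fs i)) ∧
    (∃ (E : Fin n → Set (Fin n → ℝ)) (d : Fin n → Fin n → ℤ),
      Function.Injective E ∧
      (∀ i, IsEdgeOf Q (E i) ∧ q ∈ E i ∧ EdgeDirAt q (E i) (d i)) ∧
      (∀ E', IsEdgeOf Q E' → q ∈ E' → ∃ i, E' = E i) ∧
      IsUnit (Matrix.det (Matrix.of d))) := by
  refine ⟨⟨fun i => cornerFace Q q a {i}, ?_, fun i => ⟨⟨h.isFaceOf_cornerFace _,
    ⟨q, h.mem_cornerFace _⟩, ?_⟩, h.mem_cornerFace _⟩, fun F hF hqF => ?_⟩,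
    fun i => cornerFace Q q a {i}ᶜ, d, ?_, fun i => ⟨⟨h.isFaceOf_cornerFace _, ?_⟩,
      h.mem_cornerFace _, isPrimitiveZ_of_dual h.dual i, ?_⟩, fun E' hE' hqE' => ?_,
    isUnit_det_of_dual h.dual⟩
  · exact h.cornerFace_injective.comp Finset.singleton_injective
  · simpa using h.dimSet_cornerFace_add_card {i}
  · obtain ⟨J, rfl⟩ := h.exists_eq_cornerFace hF.1 hqF
    have hJ : J.card = 1 := by
      have := h.dimSet_cornerFace_add_card J
      have := hF.2.2
      omega
    obtain ⟨i, rfl⟩ := Finset.card_eq_one.1 hJ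
    exact ⟨i, rfl⟩
  · exact h.cornerFace_injective.comp (compl_injective.comp Finset.singleton_injective)
  · obtain ⟨w, hw, he⟩ := exists_segment_eq_ray hQ hc h.mem
      ((linearIndependent_realVec_of_dual h.dual).ne_zero i) (h.feasible i)
    exact ⟨q, w, hw, (h.cornerFace_compl_singleton i).trans he⟩
  · obtain ⟨s, hs, hm⟩ := h.isFeasibleDir_cornerFace (J := {i}ᶜ) (l := i) (by simp)
    exact ⟨_, hm, s, hs, fun k => by simp [realVec]⟩
  · obtain ⟨J, rfl⟩ := h.exists_eq_cornerFace hE'.1 hqE'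
    obtain ⟨x, y, hxy, he⟩ := hE'.2
    have hdim : dimSet (cornerFace Q q a J) = 1 := by
      rw [dimSet, he, vectorSpan_segment]
      exact finrank_span_singleton (sub_ne_zero.2 hxy.symm)
    have hJ : Jᶜ.card = 1 := by
      have := h.dimSet_cornerFace_add_card J
      rw [Finset.card_compl, Fintype.card_fin]
      omega
    obtain ⟨i, hi⟩ := Finset.card_eq_one.1 hJ
    exact ⟨i, congrArg (cornerFace Q q a) (by rw [← hi, compl_compl])⟩

lemma mono (h : IsUnimodularCorner Q q a d) {R : Set (Fin n → ℝ)} (hR : R ⊆ Q) (hq : q ∈ R)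
    (hf : ∀ i, IsFeasibleDir R q (realVec (d i))) : IsUnimodularCorner R q a d :=
  ⟨hq, h.dual, fun x hx => h.nonneg x (hR hx), hf⟩

/-- The primitive outer normal of a facet through a unimodular corner is the negative of one of the
inner normals of the corner. -/
lemma exists_eq_neg_of_isFacetNormal (h : IsUnimodularCorner Q q a d) {F : Set (Fin n → ℝ)}
    {u : Fin n → ℤ} (hu : IsFacetNormal Q F u) (hq : q ∈ F) :
    ∃ j, F = cornerFace Q q a {j} ∧ u = -a j := by
  obtain ⟨hprim, hF, hFeq⟩ := hu
  obtain ⟨J, hFJ⟩ := h.exists_eq_cornerFace hF.1 hq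
  have hJ : J.card = 1 := by
    have := h.dimSet_cornerFace_add_card J
    have := hF.2.2
    rw [hFJ] at this
    omega
  obtain ⟨j, rfl⟩ := Finset.card_eq_one.1 hJ
  refine ⟨j, hFJ, ?_⟩
  have hmax : ∀ y ∈ Q, dotZ u y ≤ dotZ u q := by
    rw [hFeq] at hq
    exact hq.2
  have hzero : ∀ l, l ≠ j → u ⬝ᵥ d l = 0 := fun l hl => by
    obtain ⟨s, hs, hm⟩ := h.isFeasibleDir_cornerFace (J := {j}) (l := l) (by simpa using hl)
    rw [← hFJ, hFeq] at hm
    have h1 := hm.2 q h.mem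
    have h2 := hmax _ hm.1
    rw [dotZ_add, dotZ_smul, dotZ_realVec] at h1 h2
    have : s * ((u ⬝ᵥ d l : ℤ) : ℝ) = 0 := by linarith
    simpa [hs.ne'] using this
  have hneg : u ⬝ᵥ d j ≤ 0 := by
    obtain ⟨s, hs, hm⟩ := h.feasible j
    have h2 := hmax _ hm
    rw [dotZ_add, dotZ_smul, dotZ_realVec] at h2
    by_contra! hpos
    have : (0 : ℝ) < ((u ⬝ᵥ d j : ℤ) : ℝ) := by exact_mod_cast hpos
    linarith [mul_pos hs this]
  have hu' : u = (u ⬝ᵥ d j) • a j := by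
    conv_lhs => rw [eq_sum_dotProduct_smul_of_dual h.dual u]
    exact Finset.sum_eq_single j (fun l _ hl => by rw [hzero l hl, zero_smul]) (by simp)
  have hunit : IsUnit (u ⬝ᵥ d j) := by
    refine isUnit_of_dvd_one ?_
    rw [← show Finset.univ.gcd u = 1 from hprim]
    refine Finset.dvd_gcd fun k _ => ⟨a j k, ?_⟩
    exact congrFun hu' k
  rcases Int.isUnit_iff.1 hunit with h1 | h1
  · omega
  · rw [h1] at hu'
    rw [hu', neg_one_smul]

/-- At a unimodular corner contained in the face `F`, the central normal vector of `F` is minus a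
sum of distinct inner normals of the corner, and it is maximized at the corner. -/
lemma exists_centralNormal_eq (h : IsUnimodularCorner Q q a d) {F : Set (Fin n → ℝ)}
    {u : Fin n → ℤ} (hu : IsCentralNormal Q F u) (hq : q ∈ F) :
    ∃ I : Finset (Fin n), u = -∑ j ∈ I, a j := by
  obtain ⟨m, Fs, us, hinj, hFs, -, rfl⟩ := hu
  choose j hjF hju using fun i => h.exists_eq_neg_of_isFacetNormal (hFs i).2 ((hFs i).1 hq)
  have hj : Function.Injective j := fun i i' e => hinj (by rw [hjF i, hjF i', e])
  refine ⟨Finset.univ.image j, ?_⟩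
  rw [Finset.sum_image hj.injOn, ← Finset.sum_neg_distrib]
  exact Finset.sum_congr rfl fun i _ => hju i

end IsUnimodularCorner

section Polytopes

variable {n : ℕ}

lemma exists_subset_convexHull_eq (V : Finset (Fin n → ℝ)) :
    ∃ W ⊆ V, convexHull ℝ (W : Set (Fin n → ℝ)) = convexHull ℝ (V : Set (Fin n → ℝ)) ∧
      ∀ v ∈ W, v ∉ convexHull ℝ ((W.erase v : Finset (Fin n → ℝ)) : Set (Fin n → ℝ)) := by
  induction V using Finset.strongInduction with
  | H V ih =>
    by_cases hV : ∀ v ∈ V, v ∉ convexHull ℝ ((V.erase v : Finset (Fin n → ℝ)) : Set (Fin n → ℝ))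
    · exact ⟨V, subset_rfl, rfl, hV⟩
    · push Not at hV
      obtain ⟨v, hvV, hv⟩ := hV
      obtain ⟨W, hWV, hW, hWmin⟩ := ih _ (Finset.erase_ssubset hvV)
      refine ⟨W, hWV.trans (Finset.erase_subset _ _), hW.trans ?_, hWmin⟩
      refine (convexHull_mono (by simp)).antisymm
        (convexHull_min (fun x hx => ?_) (convex_convexHull ℝ _))
      by_cases hxv : x = v
      · exact hxv ▸ hv
      · exact subset_convexHull ℝ _ (Finset.mem_coe.2 (Finset.mem_erase.2 ⟨hxv, hx⟩))

lemma exists_dotR_lt_of_notMem_convexHull_erase {W : Finset (Fin n → ℝ)} {v : Fin n → ℝ}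
    (hv : v ∉ convexHull ℝ ((W.erase v : Finset (Fin n → ℝ)) : Set (Fin n → ℝ))) :
    ∃ c, ∀ x ∈ W, x ≠ v → dotR c x < dotR c v := by
  obtain ⟨f, r, hf, hr⟩ := geometric_hahn_banach_closed_point (convex_convexHull ℝ _)
    ((W.erase v).finite_toSet.isClosed_convexHull ℝ) hv
  obtain ⟨c, hc⟩ := exists_dotR_eq (f : (Fin n → ℝ) →ₗ[ℝ] ℝ)
  refine ⟨c, fun x hx hxv => ?_⟩
  rw [← hc, ← hc]
  exact (hf x (subset_convexHull ℝ _ (Finset.mem_coe.2 (Finset.mem_erase.2 ⟨hxv, hx⟩)))).trans hr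

lemma convex_halfspace_union_ray (c v y : Fin n → ℝ) (hy : dotR c y = 0) :
    Convex ℝ {x | dotR c (x - v) < 0 ∨ ∃ r : ℝ, 0 ≤ r ∧ x - v = r • y} := by
  intro x hx x' hx' s t hs ht hst
  have key : s • x + t • x' - v = s • (x - v) + t • (x' - v) := by
    conv_lhs => rw [← one_smul ℝ v, ← hst]
    module
  simp only [Set.mem_ofPred_eq, key] at hx hx' ⊢
  rcases hs.eq_or_lt with rfl | hs
  · obtain rfl : t = 1 := by simpa using hst
    simpa using hx'
  rcases ht.eq_or_lt with rfl | ht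
  · obtain rfl : s = 1 := by simpa using hst
    simpa using hx
  rw [dotR_add, dotR_smul, dotR_smul]
  rcases hx with hx | ⟨r, hr, hx⟩ <;> rcases hx' with hx' | ⟨r', hr', hx'⟩
  · exact .inl (add_neg (mul_neg_of_pos_of_neg hs hx) (mul_neg_of_pos_of_neg ht hx'))
  · left
    rw [hx', dotR_smul, hy]
    linarith [mul_neg_of_pos_of_neg hs hx]
  · left
    rw [hx, dotR_smul, hy]
    linarith [mul_neg_of_pos_of_neg ht hx']
  · refine .inr ⟨s * r + t * r', by positivity, ?_⟩
    rw [hx, hx']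
    module

lemma dotR_lt_of_mem_convexHull {W : Set (Fin n → ℝ)} {c v : Fin n → ℝ}
    (hc : ∀ x ∈ W, x ≠ v → dotR c x < dotR c v) {x : Fin n → ℝ} (hx : x ∈ convexHull ℝ W)
    (hxv : x ≠ v) : dotR c x < dotR c v := by
  have h := convexHull_min (fun x hx => ?_)
    (convex_halfspace_union_ray c v 0 (by simp [dotR])) hx
  · simpa [dotR_sub, sub_eq_zero, hxv] using h
  · by_cases hxv : x = v
    · exact .inr ⟨0, le_rfl, by simp [hxv]⟩
    · exact .inl (by simpa [dotR_sub] using hc x hx hxv)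

lemma IsVertexOf.mem {P : Set (Fin n → ℝ)} {v : Fin n → ℝ} (hv : IsVertexOf P v) : v ∈ P := by
  obtain ⟨c, hc⟩ := hv
  exact (hc.subset rfl).1

lemma IsVertexOf.exists_dotR_lt {P : Set (Fin n → ℝ)} {v : Fin n → ℝ} (hv : IsVertexOf P v) :
    ∃ c, ∀ x ∈ P, x ≠ v → dotR c x < dotR c v := by
  obtain ⟨c, hc⟩ := hv
  refine ⟨c, fun x hx hxv => ?_⟩
  have hmax := (hc.subset rfl).2
  by_contra! hle
  exact hxv (hc.superset ⟨hx, fun y hy => (hmax y hy).trans hle⟩)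

lemma isVertexOf_of_dotR_lt {P : Set (Fin n → ℝ)} {v c : Fin n → ℝ} (hv : v ∈ P)
    (hc : ∀ x ∈ P, x ≠ v → dotR c x < dotR c v) : IsVertexOf P v := by
  refine ⟨c, ?_⟩
  ext x
  constructor
  · rintro rfl
    refine ⟨hv, fun y hy => ?_⟩
    by_cases hyx : y = x
    · rw [hyx]
    · exact (hc y hy hyx).le
  · rintro ⟨hx, hmax⟩
    by_contra hxv
    exact absurd (hmax v hv) (hc x hx hxv).not_ge

lemma IsVertexOf.mem_extremePoints {P : Set (Fin n → ℝ)} {v : Fin n → ℝ} (hv : IsVertexOf P v) :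
    v ∈ P.extremePoints ℝ := by
  obtain ⟨c, hc⟩ := hv.exists_dotR_lt
  have hle : ∀ x ∈ P, dotR c x ≤ dotR c v := fun x hx => by
    by_cases hxv : x = v
    · rw [hxv]
    · exact (hc x hx hxv).le
  refine _root_.mem_extremePoints.2 ⟨hv.mem, fun x hx y hy hxy => ?_⟩
  obtain ⟨s, t, hs, ht, hst, he⟩ := hxy
  have hval : s * dotR c x + t * dotR c y = dotR c v := by
    rw [← dotR_smul, ← dotR_smul, ← dotR_add, he]
  have hst' : s * dotR c v + t * dotR c v = dotR c v := by rw [← add_mul, hst, one_mul]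
  constructor <;> by_contra hne
  · linarith [mul_lt_mul_of_pos_left (hc x hx hne) hs, mul_le_mul_of_nonneg_left (hle y hy) ht.le]
  · linarith [mul_lt_mul_of_pos_left (hc y hy hne) ht, mul_le_mul_of_nonneg_left (hle x hx) hs.le]

/-- A polytope is the convex hull of finitely many vertices. -/
lemma exists_convexHull_eq_forall_isVertexOf (V : Finset (Fin n → ℝ)) :
    ∃ W : Finset (Fin n → ℝ),
      convexHull ℝ (W : Set (Fin n → ℝ)) = convexHull ℝ (V : Set (Fin n → ℝ)) ∧
      ∀ v ∈ W, IsVertexOf (convexHull ℝ (V : Set (Fin n → ℝ))) v := by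
  obtain ⟨W, -, hW, hWmin⟩ := exists_subset_convexHull_eq V
  refine ⟨W, hW, fun v hv => ?_⟩
  obtain ⟨c, hc⟩ := exists_dotR_lt_of_notMem_convexHull_erase (hWmin v hv)
  rw [← hW]
  exact isVertexOf_of_dotR_lt (subset_convexHull ℝ _ hv)
    fun x hx hxv => dotR_lt_of_mem_convexHull hc hx hxv

/-- Every point `q` of a polytope has a generator `x`, of at least the same height in a given
direction, such that `q` can be moved parallel to `y - x` for every point `y` of the polytope. -/
lemma exists_mem_forall_isFeasibleDir {W : Finset (Fin n → ℝ)} {q : Fin n → ℝ}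
    (hq : q ∈ convexHull ℝ (W : Set (Fin n → ℝ))) (u : Fin n → ℤ) :
    ∃ x ∈ W, dotZ u q ≤ dotZ u x ∧ ∀ y ∈ convexHull ℝ (W : Set (Fin n → ℝ)),
      IsFeasibleDir (convexHull ℝ (W : Set (Fin n → ℝ))) q (y - x) := by
  obtain ⟨w, hw0, hw1, rfl⟩ := Finset.mem_convexHull'.1 hq
  obtain ⟨x, hxW, hx, hux⟩ : ∃ x ∈ W, 0 < w x ∧ dotZ u (∑ y ∈ W, w y • y) ≤ dotZ u x := by
    by_contra! hlt
    have hle : ∀ x ∈ W, w x * dotZ u x ≤ w x * dotZ u (∑ y ∈ W, w y • y) := fun x hx => by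
      rcases (hw0 x hx).eq_or_lt with h0 | h0
      · rw [← h0, zero_mul, zero_mul]
      · exact mul_le_mul_of_nonneg_left (hlt x hx h0).le h0.le
    obtain ⟨x, hx, hxpos⟩ : ∃ x ∈ W, 0 < w x :=
      Finset.exists_lt_of_sum_lt (f := fun _ => 0) (by rw [hw1]; simp)
    have := Finset.sum_lt_sum hle ⟨x, hx, mul_lt_mul_of_pos_left (hlt x hx hxpos) hxpos⟩
    rw [← Finset.sum_mul, hw1, one_mul, dotZ_sum] at this
    simp [dotZ_smul] at this
  refine ⟨x, hxW, hux, fun y hy => ⟨w x, hx, ?_⟩⟩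
  have hmem := (convex_convexHull ℝ (W : Set (Fin n → ℝ))).sum_mem hw0 hw1
    (z := fun z => z + if z = x then y - x else 0) fun z hz => by
      by_cases hzx : z = x
      · simpa [hzx] using hy
      · simpa [hzx] using subset_convexHull ℝ _ hz
  simpa [smul_add, Finset.sum_add_distrib, hxW] using hmem

/-- At a vertex of a smooth polytope, every generator lies in the cone spanned by the edges. -/
lemma IsVertexOf.exists_isUnimodularCorner {W : Finset (Fin n → ℝ)} {v : Fin n → ℝ}
    (hv : IsVertexOf (convexHull ℝ (W : Set (Fin n → ℝ))) v)
    (hsm : IsSmoothPolytope (convexHull ℝ (W : Set (Fin n → ℝ)))) :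
    ∃ a d, IsUnimodularCorner (convexHull ℝ (W : Set (Fin n → ℝ))) v a d := by
  set P := convexHull ℝ (W : Set (Fin n → ℝ)) with hP
  have hPconv : Convex ℝ P := convex_convexHull ℝ _
  have hPcomp : IsCompact P := W.finite_toSet.isCompact_convexHull ℝ
  obtain ⟨-, E, d, -, hE, hEall, hdet⟩ := hsm v hv
  set a : Fin n → Fin n → ℤ := fun i => ((Matrix.of d)⁻¹).transpose i with ha
  have hdual : ∀ i j, a i ⬝ᵥ d j = if i = j then 1 else 0 := fun i j => by
    have := congrFun (congrFun (Matrix.mul_nonsing_inv (Matrix.of d) hdet) j) i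
    rw [Matrix.mul_apply', Matrix.one_apply] at this
    rw [dotProduct_comm]
    exact this.trans (by simp only [eq_comm])
  refine ⟨a, d, hv.mem, hdual, fun x hx i => ?_, fun i => ?_⟩
  swap
  · obtain ⟨-, w, hw, t, ht, he⟩ := (hE i).2.2
    obtain ⟨c, hc⟩ := (hE i).1.1
    have hwP : w ∈ P := (hc.subset hw).1
    refine ⟨t, ht, ?_⟩
    convert hwP using 1
    ext k
    simp only [Pi.add_apply, Pi.smul_apply, smul_eq_mul, realVec, ← he k]
    ring
  obtain ⟨c, hc⟩ := hv.exists_dotR_lt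
  set φ : (Fin n → ℝ) → (Fin n → ℝ) := fun x => (dotR c (v - x))⁻¹ • (x - v) with hφ
  have hpos : ∀ x ∈ W, x ≠ v → 0 < dotR c (v - x) := fun x hx hxv => by
    rw [dotR_sub, sub_pos]
    exact hc x (subset_convexHull ℝ _ hx) hxv
  have hφc : ∀ x ∈ W, x ≠ v → dotR c (φ x) = -1 := fun x hx hxv => by
    have := (hpos x hx hxv).ne'
    simp only [hφ, dotR_smul]
    rw [← neg_sub v x, show dotR c (-(v - x)) = -dotR c (v - x) from dotProduct_neg _ _]
    field_simp
  have hsub : ∀ x ∈ W, x ≠ v → x - v = dotR c (v - x) • φ x := fun x hx hxv => by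
    simp only [hφ]
    rw [smul_inv_smul₀ (hpos x hx hxv).ne']
  obtain ⟨Y, hYsub, hY, hYmin⟩ := exists_subset_convexHull_eq ((W.erase v).image φ)
  have hYnonneg : ∀ y ∈ Y, ∀ i, 0 ≤ dotZ (a i) y := by
    intro y hy i
    obtain ⟨g, hg⟩ := exists_dotR_lt_of_notMem_convexHull_erase (hYmin y hy)
    obtain ⟨x₀, hx₀, rfl⟩ := Finset.mem_image.1 (hYsub hy)
    obtain ⟨hx₀v, hx₀W⟩ := Finset.mem_erase.1 hx₀
    set y := φ x₀
    have hgh : ∀ z, dotR (g + dotR g y • c) z = dotR g z + dotR g y * dotR c z := fun z => by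
      simp only [dotR_eq_dotProduct, add_dotProduct, smul_dotProduct, smul_eq_mul]
    set h := g + dotR g y • c
    have hhy : dotR h y = 0 := by rw [hgh, hφc x₀ hx₀W hx₀v]; ring
    have hy0 : y ≠ 0 := fun e => by
      have := hφc x₀ hx₀W hx₀v
      change dotR c y = -1 at this
      rw [e] at this
      simp [dotR] at this
    have hcase : ∀ x ∈ P, dotR h (x - v) < 0 ∨ ∃ r : ℝ, 0 ≤ r ∧ x - v = r • y := by
      refine fun x hx => convexHull_min (fun x hx => ?_) (convex_halfspace_union_ray h v y hhy) hx
      by_cases hxv : x = v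
      · exact .inr ⟨0, le_rfl, by simp [hxv]⟩
      by_cases hxy : φ x = y
      · exact .inr ⟨_, (hpos x hx hxv).le, hxy ▸ hsub x hx hxv⟩
      · left
        have hxY : φ x ∈ convexHull ℝ (Y : Set (Fin n → ℝ)) :=
          hY ▸ subset_convexHull ℝ _
            (Finset.mem_image_of_mem φ (Finset.mem_erase.2 ⟨hxv, hx⟩))
        have := dotR_lt_of_mem_convexHull hg hxY hxy
        rw [hsub x hx hxv, dotR_smul, hgh, hφc x hx hxv]
        exact mul_neg_of_pos_of_neg (hpos x hx hxv) (by linarith)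
    have hface : {x ∈ P | ∀ z ∈ P, dotR h z ≤ dotR h x} =
        {x ∈ P | ∃ r : ℝ, 0 ≤ r ∧ x = v + r • y} := by
      ext x
      refine and_congr_right fun hx => ⟨fun hmax => ?_, ?_⟩
      · rcases hcase x hx with hlt | ⟨r, hr, he⟩
        · have := hmax v hv.mem
          rw [dotR_sub] at hlt
          linarith
        · exact ⟨r, hr, by rw [← he]; abel⟩
      · rintro ⟨r, hr, rfl⟩ z hz
        rw [dotR_add, dotR_smul, hhy]
        rcases hcase z hz with hlt | ⟨r', -, he⟩
        · rw [dotR_sub] at hlt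
          linarith
        · have := congrArg (dotR h) he
          rw [dotR_sub, dotR_smul, hhy] at this
          linarith
    have hx₀e : x₀ = v + dotR c (v - x₀) • y := by rw [← hsub x₀ hx₀W hx₀v]; abel
    have hx₀P : x₀ ∈ P := subset_convexHull ℝ _ hx₀W
    obtain ⟨w, hvw, hw⟩ := exists_segment_eq_ray hPconv hPcomp hv.mem hy0
      ⟨_, hpos x₀ hx₀W hx₀v, hx₀e ▸ hx₀P⟩
    obtain ⟨l, hl⟩ := hEall {x ∈ P | ∃ r : ℝ, 0 ≤ r ∧ x = v + r • y}
      ⟨⟨h, hface.symm⟩, v, w, hvw, hw⟩ ⟨hv.mem, 0, le_rfl, by simp⟩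
    obtain ⟨-, w', hw', t, ht, he⟩ := (hE l).2.2
    rw [← hl] at hw'
    obtain ⟨-, r, hr, rfl⟩ := hw'
    have hry : r • y = t • realVec (d l) := by
      ext k
      simpa [realVec] using he k
    have hr' : r * dotZ (a i) y = t * if i = l then 1 else 0 := by
      rw [← dotZ_realVec_of_dual hdual, ← dotZ_smul, ← dotZ_smul, hry]
    have hrpos : 0 < r := by
      refine hr.lt_of_ne fun h0 => ?_
      have := congrArg (dotZ (a l)) hry
      rw [← h0, zero_smul, dotZ_zero, dotZ_smul, dotZ_realVec_of_dual hdual, if_pos rfl] at this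
      linarith
    refine nonneg_of_mul_nonneg_right (a := r) ?_ hrpos
    rw [hr']
    split_ifs <;> simp [ht.le]
  have hcone : ∀ y ∈ convexHull ℝ (Y : Set (Fin n → ℝ)), 0 ≤ dotZ (a i) y := fun y hy =>
    convexHull_min (fun y hy => hYnonneg y hy i) (convex_le_dotZ (a i) 0) hy
  have hW : (W : Set (Fin n → ℝ)) ⊆ {x | dotZ (a i) v ≤ dotZ (a i) x} := fun x hx => by
    by_cases hxv : x = v
    · simp [hxv]
    · have h1 := hcone (φ x) (hY ▸ subset_convexHull ℝ _
        (Finset.mem_image_of_mem φ (Finset.mem_erase.2 ⟨hxv, hx⟩)))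
      have h2 := congrArg (dotZ (a i)) (hsub x hx hxv)
      rw [dotZ_sub, dotZ_smul] at h2
      have := mul_nonneg (hpos x hx hxv).le h1
      simp only [Set.mem_ofPred_eq]
      linarith
  rw [dotZ_sub, sub_nonneg]
  exact convexHull_min hW (convex_le_dotZ (a i) _) hx

end Polytopes

section Truncation

variable {n : ℕ} {P : Set (Fin n → ℝ)} {q z : Fin n → ℝ} {u : Fin n → ℤ} {β : ℝ}

lemma IsFeasibleDir.truncate (hz : IsFeasibleDir P q z) (hq : dotZ u q ≤ β)
    (huz : dotZ u z ≤ 0) : IsFeasibleDir {x ∈ P | dotZ u x ≤ β} q z := by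
  obtain ⟨s, hs, hm⟩ := hz
  refine ⟨s, hs, hm, ?_⟩
  rw [dotZ_add, dotZ_smul]
  linarith [mul_nonpos_of_nonneg_of_nonpos hs.le huz]

lemma IsFeasibleDir.truncate_of_lt (hP : Convex ℝ P) (hqP : q ∈ P) (hz : IsFeasibleDir P q z)
    (hq : dotZ u q < β) : IsFeasibleDir {x ∈ P | dotZ u x ≤ β} q z := by
  obtain ⟨s, hs, hm⟩ := hz.exists_forall_le hP hqP
  rcases le_or_gt (dotZ u z) 0 with h0 | h0
  · exact IsFeasibleDir.truncate ⟨s, hs, hm s hs.le le_rfl⟩ hq.le h0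
  · have hpos : 0 < (β - dotZ u q) / dotZ u z := div_pos (sub_pos.2 hq) h0
    refine ⟨min s ((β - dotZ u q) / dotZ u z), lt_min hs hpos,
      hm _ (lt_min hs hpos).le (min_le_left _ _), ?_⟩
    rw [dotZ_add, dotZ_smul]
    have := (le_div_iff₀ h0).1 (min_le_right s ((β - dotZ u q) / dotZ u z))
    linarith

/-- An extreme point of a truncated polytope strictly below the cut is a generator of the
polytope. -/
lemma mem_of_mem_extremePoints_truncate {W : Finset (Fin n → ℝ)}
    (hq : q ∈ Set.extremePoints ℝ {x ∈ convexHull ℝ (W : Set (Fin n → ℝ)) | dotZ u x ≤ β})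
    (hlt : dotZ u q < β) : q ∈ W := by
  have hconv := convex_convexHull ℝ (W : Set (Fin n → ℝ))
  obtain ⟨x, hxW, -, hx⟩ := exists_mem_forall_isFeasibleDir hq.1.1 u
  have h1 := (hx q hq.1.1).truncate_of_lt hconv hq.1.1 hlt
  have h2 : IsFeasibleDir _ q (x - q) := .of_mem (subset_convexHull ℝ _ hxW)
  have h3 := h2.truncate_of_lt hconv hq.1.1 hlt
  rw [← neg_sub] at h3
  have := eq_zero_of_mem_extremePoints (hconv.inter (convex_dotZ_le u β)) hq h1 h3
  rwa [sub_eq_zero.1 this]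

namespace IsUnimodularCorner

variable {f : Fin n → ℝ} {a d : Fin n → Fin n → ℤ} {I : Finset (Fin n)}

lemma dotZ_neg_sum (h : IsUnimodularCorner P f a d) (l : Fin n) :
    dotZ (-∑ i ∈ I, a i) (realVec (d l)) = if l ∈ I then -1 else 0 := by
  simp only [neg_dotZ, sum_dotZ, dotZ_realVec_of_dual h.dual, Finset.sum_ite_eq']
  split_ifs <;> simp

/-- An extreme point of a truncated polytope which lies on the cut, and from which every edge
direction of a corner `f` above the cut is feasible, lies on an edge through `f`. -/
lemma exists_eq_add_smul (h : IsUnimodularCorner P f a d) (hP : Convex ℝ P)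
    (hq : q ∈ Set.extremePoints ℝ {x ∈ P | dotZ (-∑ i ∈ I, a i) x ≤ β})
    (hqβ : dotZ (-∑ i ∈ I, a i) q = β) (hf : β < dotZ (-∑ i ∈ I, a i) f)
    (hfeas : ∀ l, IsFeasibleDir P q (realVec (d l))) :
    ∃ j ∈ I, q = f + (dotZ (-∑ i ∈ I, a i) f - β) • realVec (d j) ∧
      IsFeasibleDir P q (-realVec (d j)) := by
  set u := -∑ i ∈ I, a i with hu
  have hqP := hq.1.1
  have hconv : Convex ℝ {x ∈ P | dotZ u x ≤ β} := hP.inter (convex_dotZ_le u β)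
  have hud : ∀ l, dotZ u (realVec (d l)) = if l ∈ I then -1 else 0 := h.dotZ_neg_sum
  have hlin := linearIndependent_realVec_of_dual h.dual
  have hexp := eq_sum_smul_realVec_of_dual h.dual (q - f)
  have hs0 := h.nonneg q hqP
  set s : Fin n → ℝ := fun l => dotZ (a l) (q - f) with hs
  change ∀ i, 0 ≤ s i at hs0
  change q - f = ∑ l, s l • realVec (d l) at hexp
  have hback : ∀ l, 0 < s l → IsFeasibleDir P q (-realVec (d l)) := fun l hl => by
    have h1 : IsFeasibleDir P q (f - q) := .of_mem h.mem
    have h2 : IsFeasibleDir P q (∑ i ∈ Finset.univ.erase l, s i • realVec (d i)) :=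
      .sum hP hqP _ _ fun i _ => by
        rcases (hs0 i).eq_or_lt with h0 | h0
        · rw [← h0, zero_smul]
          exact .zero hqP
        · exact (hfeas i).smul h0
    have h3 := (h1.add hP hqP h2).smul (inv_pos.2 hl)
    convert h3 using 1
    rw [← neg_sub q f, hexp, ← Finset.add_sum_erase _ _ (Finset.mem_univ l), neg_add_rev,
      add_right_comm, neg_add_cancel, zero_add, smul_neg, inv_smul_smul₀ hl.ne']
  have hsum : ∑ l ∈ I, s l = dotZ u f - β := by
    have := congrArg (dotZ u) hexp
    simp only [dotZ_sub, dotZ_sum, dotZ_smul, hud, hqβ, mul_ite, mul_zero, mul_neg, mul_one,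
      Finset.sum_ite_mem, Finset.univ_inter, Finset.sum_neg_distrib] at this
    linarith
  obtain ⟨j, hjI, hj⟩ : ∃ j ∈ I, 0 < s j :=
    Finset.exists_lt_of_sum_lt (f := fun _ => 0) (by rw [hsum]; simpa using hf)
  have hzero : ∀ l, l ≠ j → s l = 0 := fun l hlj => by
    by_contra hne
    have hl : 0 < s l := (hs0 l).lt_of_ne' hne
    by_cases hlI : l ∈ I
    · have h1 := ((hfeas l).add hP hqP (hback j hj)).truncate (u := u) hqβ.le (by
        rw [dotZ_add, dotZ_neg, hud, hud, if_pos hlI, if_pos hjI]; simp)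
      have h2 := ((hback l hl).add hP hqP (hfeas j)).truncate (u := u) hqβ.le (by
        rw [dotZ_add, dotZ_neg, hud, hud, if_pos hlI, if_pos hjI]; simp)
      rw [← neg_neg (-realVec (d l) + _), neg_add, neg_neg] at h2
      rw [← neg_neg (realVec (d l) + _)] at h1
      have := eq_zero_of_mem_extremePoints hconv hq (neg_neg (realVec (d l) + _) ▸ h1) h2
      exact hlj (hlin.injective (add_neg_eq_zero.1 this))
    · have h1 := (hfeas l).truncate (u := u) hqβ.le (by rw [hud, if_neg hlI])
      have h2 := (hback l hl).truncate (u := u) hqβ.le (by rw [dotZ_neg, hud, if_neg hlI, neg_zero])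
      exact hlin.ne_zero l (eq_zero_of_mem_extremePoints hconv hq h1 h2)
  refine ⟨j, hjI, ?_, hback j hj⟩
  rw [Finset.sum_eq_single j (fun l _ hl => hzero l hl) (by simp [hjI])] at hsum
  rw [Finset.sum_eq_single j (fun l _ hl => by rw [hzero l hl, zero_smul]) (by simp)] at hexp
  rw [← hsum, ← hexp]
  abel

/-- The new corner created by truncating a unimodular corner. -/
lemma truncate (h : IsUnimodularCorner P f a d) (hP : Convex ℝ P) (hqP : q ∈ P)
    {j : Fin n} (hj : j ∈ I) {t : ℝ} (hqf : q = f + t • realVec (d j))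
    (hqβ : dotZ (-∑ i ∈ I, a i) q = β) (hfeas : ∀ l, IsFeasibleDir P q (realVec (d l)))
    (hback : IsFeasibleDir P q (-realVec (d j))) :
    IsUnimodularCorner {x ∈ P | dotZ (-∑ i ∈ I, a i) x ≤ β} q
      (fun i => if i = j then ∑ l ∈ I, a l else a i)
      (fun l => if l ∈ I.erase j then d l - d j else d l) := by
  have hsumd : ∀ l, (∑ i ∈ I, a i) ⬝ᵥ d l = if l ∈ I then 1 else 0 := fun l => by
    simp only [sum_dotProduct, h.dual, Finset.sum_ite_eq']
  refine ⟨⟨hqP, hqβ.le⟩, fun i l => ?_, fun x hx i => ?_, fun l => ?_⟩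
  · rcases eq_or_ne i j with rfl | hij
    · by_cases hl : l ∈ I.erase i
      · obtain ⟨hli, hlI⟩ := Finset.mem_erase.1 hl
        simp only [if_pos hl, if_true, dotProduct_sub, hsumd, if_pos hlI, if_pos hj, sub_self,
          if_neg hli.symm]
      · rcases eq_or_ne l i with rfl | hli
        · simp [hsumd, hj]
        · have hlI : l ∉ I := fun hlI => hl (Finset.mem_erase.2 ⟨hli, hlI⟩)
          simp [hsumd, hlI, hli.symm]
    · by_cases hl : l ∈ I.erase j
      · simp only [if_neg hij, if_pos hl, dotProduct_sub, h.dual, sub_zero]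
      · simp only [if_neg hij, if_neg hl, h.dual]
  · by_cases hij : i = j
    · have := hx.2
      rw [neg_dotZ] at this hqβ
      simp only [if_pos hij, dotZ_sub]
      linarith
    · have := h.nonneg x hx.1 i
      simp only [if_neg hij]
      rw [hqf, ← sub_sub, dotZ_sub, dotZ_smul, dotZ_realVec_of_dual h.dual, if_neg hij]
      linarith
  · by_cases hl : l ∈ I.erase j
    · simp only [if_pos hl]
      have he : realVec (d l - d j) = realVec (d l) + -realVec (d j) := by
        ext k
        simp [realVec, sub_eq_add_neg]
      rw [he]
      refine ((hfeas l).add hP hqP hback).truncate hqβ.le ?_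
      rw [dotZ_add, dotZ_neg, h.dotZ_neg_sum, h.dotZ_neg_sum, if_pos hj,
        if_pos (Finset.mem_of_mem_erase hl)]
      simp
    · simp only [if_neg hl]
      refine (hfeas l).truncate hqβ.le ?_
      rw [h.dotZ_neg_sum]
      split_ifs <;> simp

end IsUnimodularCorner

end Truncation

lemma IsCentralNormal.dotZ_le {n : ℕ} {P F : Set (Fin n → ℝ)} {u : Fin n → ℤ}
    (hu : IsCentralNormal P F u) {f : Fin n → ℝ} (hf : f ∈ F) {y : Fin n → ℝ} (hy : y ∈ P) :
    dotZ u y ≤ dotZ u f := by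
  obtain ⟨m, Fs, us, -, hFs, -, rfl⟩ := hu
  rw [sum_dotZ, sum_dotZ]
  refine Finset.sum_le_sum fun i _ => ?_
  have := (hFs i).1 hf
  rw [(hFs i).2.2.2] at this
  exact this.2 y hy

/-- the blow-up `P ∩ {x : u_F · x ≤ b - ε}` of a smooth lattice
polytope `P` at a face `F` of codimension `k ≥ 2` (with `ε > 0` such that every
vertex of `P` not in `F` satisfies `u_F · v < b - ε`) is again a smooth
polytope. -/
theorem blowup_is_smooth {n k : ℕ} (hk : 2 ≤ k) (P F : Set (Fin n → ℝ))
    (hP : IsLatticePolytope P) (hsm : IsSmoothPolytope P)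
    (hF : HasCodim P F k) (u : Fin n → ℤ) (hu : IsCentralNormal P F u)
    (b : ℝ) (hb : IsGreatest ((fun x => dotZ u x) '' P) b)
    (ε : ℝ) (hε : 0 < ε)
    (hcut : ∀ v, IsVertexOf P v → v ∉ F → dotZ u v < b - ε) :
    IsSmoothPolytope {x ∈ P | dotZ u x ≤ b - ε} ∧
    ∃ V : Finset (Fin n → ℝ),
      {x ∈ P | dotZ u x ≤ b - ε} = convexHull ℝ (V : Set (Fin n → ℝ)) := by
  obtain ⟨V, -, hPV, -⟩ := hP
  obtain ⟨W, hW, hWvert⟩ := exists_convexHull_eq_forall_isVertexOf V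
  rw [← hPV] at hWvert hW
  subst hW
  set P := convexHull ℝ (W : Set (Fin n → ℝ))
  set Q := {x ∈ P | dotZ u x ≤ b - ε}
  have hPconv : Convex ℝ P := convex_convexHull ℝ _
  have hQconv : Convex ℝ Q := hPconv.inter (convex_dotZ_le u (b - ε))
  have hQcomp : IsCompact Q := (W.finite_toSet.isCompact_convexHull ℝ).inter_right
    (isClosed_le (continuous_dotZ u) continuous_const)
  choose! a d hcorner using fun f (hf : f ∈ W) => (hWvert f hf).exists_isUnimodularCorner hsm
  have hcase : ∀ q ∈ Q.extremePoints ℝ, (q ∈ W ∧ dotZ u q < b - ε) ∨ ∃ f ∈ W,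
      ∃ I : Finset (Fin n), ∃ j ∈ I, u = -∑ i ∈ I, a f i ∧ dotZ u q = b - ε ∧
      (∀ l, IsFeasibleDir P q (realVec (d f l))) ∧ q = f + ε • realVec (d f j) ∧
      IsFeasibleDir P q (-realVec (d f j)) := by
    intro q hq
    rcases hq.1.2.lt_or_eq with hlt | hqβ
    · exact .inl ⟨mem_of_mem_extremePoints_truncate hq hlt, hlt⟩
    obtain ⟨f, hfW, hqf, hf⟩ := exists_mem_forall_isFeasibleDir hq.1.1 u
    have hfF : f ∈ F := by
      by_contra hfF
      linarith [hcut f (hWvert f hfW) hfF]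
    obtain ⟨I, hI⟩ := (hcorner f hfW).exists_centralNormal_eq hu hfF
    obtain ⟨⟨y, hy, hyb⟩, hbmax⟩ := hb
    have hfb : dotZ u f = b :=
      le_antisymm (hbmax ⟨f, (hcorner f hfW).mem, rfl⟩) (hyb ▸ hu.dotZ_le hfF hy)
    have hfeas : ∀ l, IsFeasibleDir P q (realVec (d f l)) := fun l => by
      obtain ⟨s, hs, hm⟩ := (hcorner f hfW).feasible l
      have := (hf _ hm).smul (inv_pos.2 hs)
      rwa [add_sub_cancel_left, inv_smul_smul₀ hs.ne'] at this
    obtain ⟨j, hj, hqj, hback⟩ := (hcorner f hfW).exists_eq_add_smul hPconv (hI ▸ hq)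
      (hI ▸ hqβ) (by rw [← hI]; linarith) hfeas
    rw [← hI, hfb, sub_sub_cancel] at hqj
    exact .inr ⟨f, hfW, I, j, hj, hI, hqβ, hfeas, hqj, hback⟩
  constructor
  · intro q hq
    obtain ⟨a', d', hq'⟩ : ∃ a' d', IsUnimodularCorner Q q a' d' := by
      rcases hcase q hq.mem_extremePoints with ⟨hqW, hlt⟩ |
        ⟨f, hfW, I, j, hj, hI, hqβ, hfeas, hqj, hback⟩
      · exact ⟨_, _, (hcorner q hqW).mono (fun x hx => hx.1) hq.mem fun i =>
          ((hcorner q hqW).feasible i).truncate_of_lt hPconv hq.mem.1 hlt⟩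
      · have := (hcorner f hfW).truncate hPconv hq.mem.1 hj hqj (hI ▸ hqβ) hfeas hback
        rw [← hI] at this
        exact ⟨_, _, this⟩
    exact hq'.smooth_at hQconv hQcomp
  · have hfin : (Q.extremePoints ℝ).Finite := by
      refine (W.finite_toSet.union (W.finite_toSet.biUnion fun f _ =>
        Set.finite_range fun j => f + ε • realVec (d f j))).subset fun q hq => ?_
      rcases hcase q hq with ⟨hqW, -⟩ | ⟨f, hfW, -, j, -, -, -, -, hqj, -⟩
      · exact .inl hqW
      · exact .inr (Set.mem_biUnion hfW ⟨j, hqj.symm⟩)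
    refine ⟨hfin.toFinset, ?_⟩
    rw [hfin.coe_toFinset, ← (hfin.isClosed_convexHull ℝ).closure_eq,
      closure_convexHull_extremePoints hQcomp hQconv]
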